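/- Let m > 0 be a real number and let i < i' < j < j' be real numbers. Then the triangular arc paths intersect in exactly one point: Δ_m(i,j) ∩ Δ_m(i',j') = {((i'+j)/2, m(j−i')/2)}. Moreover this point lies in the relative interior of the descending segment of Δ_m(i,j) and in the relative interior of the ascending segment of Δ_m(i',j'). -/

import Mathlib

/-- The apex of the triangular drawing of the arc `(i,j)` with slopes `±m`. -/
noncomputable def apexPt (m i j : ℝ) : ℝ × ℝ := ((i + j) / 2, m * (j - i) / 2)

/-- The ascending segment of the triangular arc path: from `(i,0)` to the apex. -/
noncomputable def ascSeg (m i j : ℝ) : Set (ℝ × ℝ) :=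
  segment ℝ ((i, 0) : ℝ × ℝ) (apexPt m i j)

/-- The descending segment of the triangular arc path: from the apex to `(j,0)`. -/
noncomputable def descSeg (m i j : ℝ) : Set (ℝ × ℝ) :=
  segment ℝ (apexPt m i j) ((j, 0) : ℝ × ℝ)

/-- The triangular drawing `Δ_m(i,j)` of the arc `(i,j)`. -/
noncomputable def triPath (m i j : ℝ) : Set (ℝ × ℝ) := ascSeg m i j ∪ descSeg m i j

theorem ascSeg_spec (m i j : ℝ) (h : i < j) (x y : ℝ) (hp : (x, y) ∈ ascSeg m i j) :
    y = m * (x - i) ∧ x ≤ (i + j) / 2 := by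
  obtain ⟨a, b, ha, hb, hab, he⟩ := hp
  simp only [apexPt, Prod.smul_mk, smul_eq_mul, Prod.mk_add_mk, Prod.mk.injEq] at he
  obtain ⟨rfl, rfl⟩ := he
  obtain rfl : a = 1 - b := by linarith
  constructor
  · ring
  · nlinarith

theorem descSeg_spec (m i j : ℝ) (h : i < j) (x y : ℝ) (hp : (x, y) ∈ descSeg m i j) :
    y = m * (j - x) ∧ (i + j) / 2 ≤ x := by
  obtain ⟨a, b, ha, hb, hab, he⟩ := hp
  simp only [apexPt, Prod.smul_mk, smul_eq_mul, Prod.mk_add_mk, Prod.mk.injEq] at he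
  obtain ⟨rfl, rfl⟩ := he
  obtain rfl : b = 1 - a := by linarith
  constructor
  · ring
  · nlinarith

/-- For `m > 0` and `i < i' < j < j'`, the triangular arc paths intersect in exactly the
point `((i'+j)/2, m(j-i')/2)`, which lies in the relative interior of the descending
segment of `Δ_m(i,j)` and of the ascending segment of `Δ_m(i',j')`. -/
theorem stmt10 (m i i' j j' : ℝ) (hm : 0 < m) (h1 : i < i') (h2 : i' < j) (h3 : j < j') :
    triPath m i j ∩ triPath m i' j' =
      ({((i' + j) / 2, m * (j - i') / 2)} : Set (ℝ × ℝ)) ∧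
    (((i' + j) / 2, m * (j - i') / 2) : ℝ × ℝ) ∈
      openSegment ℝ (apexPt m i j) ((j, 0) : ℝ × ℝ) ∧
    (((i' + j) / 2, m * (j - i') / 2) : ℝ × ℝ) ∈
      openSegment ℝ ((i', 0) : ℝ × ℝ) (apexPt m i' j') := by
  have hA : (((i' + j) / 2, m * (j - i') / 2) : ℝ × ℝ) ∈
      openSegment ℝ (apexPt m i j) ((j, 0) : ℝ × ℝ) := by
    have h : 0 < j - i := by linarith
    refine ⟨(j - i') / (j - i), (i' - i) / (j - i), div_pos (by linarith) h,
      div_pos (by linarith) h, by field_simp; ring, ?_⟩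
    simp only [apexPt, Prod.smul_mk, smul_eq_mul, Prod.mk_add_mk, Prod.mk.injEq]
    constructor <;> field_simp <;> ring
  have hB : (((i' + j) / 2, m * (j - i') / 2) : ℝ × ℝ) ∈
      openSegment ℝ ((i', 0) : ℝ × ℝ) (apexPt m i' j') := by
    have h : 0 < j' - i' := by linarith
    refine ⟨(j' - j) / (j' - i'), (j - i') / (j' - i'), div_pos (by linarith) h,
      div_pos (by linarith) h, by field_simp; ring, ?_⟩
    simp only [apexPt, Prod.smul_mk, smul_eq_mul, Prod.mk_add_mk, Prod.mk.injEq]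
    constructor <;> field_simp <;> ring
  refine ⟨?_, hA, hB⟩
  apply Set.Subset.antisymm
  · rintro ⟨x, y⟩ ⟨hp | hp, hq | hq⟩
    · obtain ⟨e, _⟩ := ascSeg_spec m i j (by linarith) x y hp
      obtain ⟨e', _⟩ := ascSeg_spec m i' j' (by linarith) x y hq
      have := mul_left_cancel₀ hm.ne' (e.symm.trans e')
      linarith
    · obtain ⟨e, _⟩ := ascSeg_spec m i j (by linarith) x y hp
      obtain ⟨e', _⟩ := descSeg_spec m i' j' (by linarith) x y hq
      have := mul_left_cancel₀ hm.ne' (e.symm.trans e')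
      linarith
    · obtain ⟨e, _⟩ := descSeg_spec m i j (by linarith) x y hp
      obtain ⟨e', _⟩ := ascSeg_spec m i' j' (by linarith) x y hq
      have := mul_left_cancel₀ hm.ne' (e.symm.trans e')
      obtain rfl : x = (i' + j) / 2 := by linarith
      simp only [Set.mem_singleton_iff, Prod.mk.injEq, true_and]
      rw [e]; ring
    · obtain ⟨e, _⟩ := descSeg_spec m i j (by linarith) x y hp
      obtain ⟨e', _⟩ := descSeg_spec m i' j' (by linarith) x y hq
      have := mul_left_cancel₀ hm.ne' (e.symm.trans e')
      linarith
  · rintro _ rfl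
    exact ⟨Or.inr (openSegment_subset_segment _ _ _ hA),
      Or.inl (openSegment_subset_segment _ _ _ hB)⟩
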